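/- If e : A → ℂ is a unital ℂ-algebra homomorphism satisfying e(M_α^β) = δ_α^β and e(M̄_α̇^β̇) = δ_α̇^β̇, then the counit of every Lorentz generator is the Kronecker delta: e(Λ_L^K) = δ_L^K for all L, K ∈ {0,1,2,3}. -/

import Mathlib

noncomputable section

open scoped Matrix

/-- Lower undotted spinor metric `ε_{αβ}` of the two-parameter deformation. -/
def epsLo (q r : ℝ) : Matrix (Fin 2) (Fin 2) ℂ :=
  ((Real.sqrt (1 - r ^ 2) : ℂ))⁻¹ •
    !![Complex.I * (r : ℂ), -((Real.sqrt q : ℂ))⁻¹; (Real.sqrt q : ℂ), Complex.I * (r : ℂ)]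

/-- Upper undotted spinor metric `ε^{αβ}`. -/
def epsUp (q r : ℝ) : Matrix (Fin 2) (Fin 2) ℂ :=
  ((Real.sqrt (1 - r ^ 2) : ℂ))⁻¹ •
    !![Complex.I * (r : ℂ), ((Real.sqrt q : ℂ))⁻¹; -(Real.sqrt q : ℂ), Complex.I * (r : ℂ)]

/-- Lower dotted spinor metric `ε_{α̇β̇}`. -/
def epsLoD (q r : ℝ) : Matrix (Fin 2) (Fin 2) ℂ :=
  ((Real.sqrt (1 - r ^ 2) : ℂ))⁻¹ •
    !![-(Complex.I * (r : ℂ)), (Real.sqrt q : ℂ); -((Real.sqrt q : ℂ))⁻¹, -(Complex.I * (r : ℂ))]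

/-- Upper dotted spinor metric `ε^{α̇β̇}`. -/
def epsUpD (q r : ℝ) : Matrix (Fin 2) (Fin 2) ℂ :=
  ((Real.sqrt (1 - r ^ 2) : ℂ))⁻¹ •
    !![-(Complex.I * (r : ℂ)), -(Real.sqrt q : ℂ); ((Real.sqrt q : ℂ))⁻¹, -(Complex.I * (r : ℂ))]

/-- `Q = (2r + q + q⁻¹)/(1 − r²)`. -/
def Qval (q r : ℝ) : ℝ := (2 * r + q + q⁻¹) / (1 - r ^ 2)

/-- The R-matrix `R^{αβ}_{γδ} = δ^α_γ δ^β_δ + c · ε^{αβ} ε_{γδ}` (with `c = a^{±1}`). -/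
def Rm (q r : ℝ) (c : ℂ) (α β γ δ : Fin 2) : ℂ :=
  (if α = γ then 1 else 0) * (if β = δ then 1 else 0) + c * epsUp q r α β * epsLo q r γ δ

/-- The conjugate `σ̄_±^{α̇β} = a^{±1/2} Σ ε^{α̇λ̇} ε_{ρκ} R^{∓σκ}_{μν} ε^{μλ} ε^{νβ} σ_{σρ̇}`
of a 2×2 matrix `σ`; `s = true` is the `+` sign, `s = false` the `−` sign. -/
def sbar (q r a : ℝ) (s : Bool) (σ : Matrix (Fin 2) (Fin 2) ℂ) (ad b : Fin 2) : ℂ :=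
  (if s then (Real.sqrt a : ℂ) else ((Real.sqrt a : ℂ))⁻¹) *
    ∑ l, ∑ sg, ∑ rh, ∑ ka, ∑ mu, ∑ nu,
      epsUpD q r ad l * epsLo q r rh ka * Rm q r (if s then ((a : ℂ))⁻¹ else (a : ℂ)) sg ka mu nu *
        epsUp q r mu l * epsUp q r nu b * σ sg rh

/-- The quantum Pauli matrices `σ^0, σ^1, σ^2, σ^3`. -/
def pauli : Fin 4 → Matrix (Fin 2) (Fin 2) ℂ :=
  ![!![1, 0; 0, 1], !![0, 1; 1, 0], !![0, -Complex.I; Complex.I, 0], !![1, 0; 0, -1]]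

/-- The metric pairing `G_±^{IJ} = (1/Q) Σ ε^{αν} σ^I_{αβ̇} σ̄_±^{Jβ̇γ} ε_{γν}`. -/
def Gpair (q r a : ℝ) (s : Bool) (σI σJ : Matrix (Fin 2) (Fin 2) ℂ) : ℂ :=
  (1 / (Qval q r : ℂ)) * ∑ al, ∑ nu, ∑ be, ∑ ga,
    epsUp q r al nu * σI al be * sbar q r a s σJ be ga * epsLo q r ga nu

/-- The quantum Minkowski metric `G_±^{IJ}` as a 4×4 matrix. -/
def GupM (q r a : ℝ) (s : Bool) : Matrix (Fin 4) (Fin 4) ℂ :=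
  fun I J => Gpair q r a s (pauli I) (pauli J)

/-- The inverse metric `G_{±IJ}`. -/
def GloM (q r a : ℝ) (s : Bool) : Matrix (Fin 4) (Fin 4) ℂ := (GupM q r a s)⁻¹

/-- The lowered conjugate Pauli matrices `σ̄_L^{α̇β} = Σ_N G_{+LN} σ̄_+^{Nα̇β}`. -/
def sbarL (q r a : ℝ) (L : Fin 4) (ad b : Fin 2) : ℂ :=
  ∑ N, GloM q r a true L N * sbar q r a true (pauli N) ad b

/-- The quantum Lorentz group generators
`Λ_L^K = (1/Q) Σ ε_{γ̇δ̇} σ̄_L^{δ̇α} M_α^σ σ^K_{σρ̇} M̄_β̇^{ρ̇} ε^{γ̇β̇}`. -/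
def Lor {A : Type*} [Ring A] [Algebra ℂ A] (q r a : ℝ)
    (M Mb : Fin 2 → Fin 2 → A) (L K : Fin 4) : A :=
  ∑ ga, ∑ de, ∑ al, ∑ sg, ∑ rh, ∑ be,
    ((1 / (Qval q r : ℂ)) * epsLoD q r ga de * sbarL q r a L de al * pauli K sg rh *
      epsUpD q r ga be) • (M al sg * Mb be rh)

/-- The Lorentz R-matrices
`𝓡^{±NM}_{LK} = (1/Q²) Σ R^{∓ακ}_{τσ} R^{∓μβ}_{κν} R^{±ρξ}_{δα} R^{±λγ}_{ξμ}
σ^{M β̇}_γ σ^{N λ̇}_ρ σ̄_{Lτ̇}^δ σ̄_{Kν̇}^σ`. -/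
def Rlor (q r a : ℝ) (s : Bool) (N M L K : Fin 4) : ℂ :=
  (1 / (Qval q r : ℂ) ^ 2) *
    ∑ al, ∑ be, ∑ ga, ∑ de, ∑ ka, ∑ l, ∑ mu, ∑ nu, ∑ xi, ∑ rh, ∑ sg, ∑ ta,
      Rm q r (if s then ((a : ℂ))⁻¹ else (a : ℂ)) al ka ta sg *
        Rm q r (if s then ((a : ℂ))⁻¹ else (a : ℂ)) mu be ka nu *
          Rm q r (if s then (a : ℂ) else ((a : ℂ))⁻¹) rh xi de al *
            Rm q r (if s then (a : ℂ) else ((a : ℂ))⁻¹) l ga xi mu *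
              (∑ p, epsUpD q r be p * pauli M ga p) *
                (∑ p, epsUpD q r l p * pauli N rh p) *
                  (∑ p, epsLoD q r ta p * sbarL q r a L p de) *
                    (∑ p, epsLoD q r nu p * sbarL q r a K p sg)

end

section

open scoped Matrix

theorem epsLo_mul_epsUp {q r : ℝ} (hq : 0 < q) (hr : r ^ 2 < 1) :
    epsLo q r * epsUp q r = 1 := by
  have hs : (Real.sqrt q : ℂ) ≠ 0 := by
    exact_mod_cast (Real.sqrt_pos.2 hq).ne'
  have hd : (Real.sqrt (1 - r ^ 2) : ℂ) ≠ 0 := by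
    exact_mod_cast (Real.sqrt_pos.2 (sub_pos.2 hr)).ne'
  have hd2 : (Real.sqrt (1 - r ^ 2) : ℂ) ^ 2 = 1 - (r : ℂ) ^ 2 := by
    exact_mod_cast Real.sq_sqrt (sub_pos.2 hr).le
  ext i j
  fin_cases i <;> fin_cases j <;>
    simp [epsLo, epsUp, Matrix.mul_apply, Fin.sum_univ_two] <;> field_simp <;>
    simp [hd2] <;> ring

theorem epsUp_mul_epsLo {q r : ℝ} (hq : 0 < q) (hr : r ^ 2 < 1) :
    epsUp q r * epsLo q r = 1 :=
  mul_eq_one_comm.1 (epsLo_mul_epsUp hq hr)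

theorem epsUpD_eq_neg_transpose (q r : ℝ) : epsUpD q r = -(epsLo q r)ᵀ := by
  ext i j
  fin_cases i <;> fin_cases j <;> simp [epsLo, epsUpD]

theorem epsLoD_eq_neg_transpose (q r : ℝ) : epsLoD q r = -(epsUp q r)ᵀ := by
  ext i j
  fin_cases i <;> fin_cases j <;> simp [epsUp, epsLoD]

theorem sbar_true_eq {q r : ℝ} (hq : 0 < q) (hr : r ^ 2 < 1) (a : ℝ)
    (σ : Matrix (Fin 2) (Fin 2) ℂ) :
    Matrix.of (sbar q r a true σ) =
      -(Real.sqrt a : ℂ) • (σ + ((a : ℂ)⁻¹ * (σ * epsLo q r * (epsUp q r)ᵀ).trace) • 1) := by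
  have key : Matrix.of (sbar q r a true σ) = (Real.sqrt a : ℂ) •
      (epsUpD q r * (epsUp q r)ᵀ * σ * (epsLo q r * epsUp q r) +
        ((a : ℂ)⁻¹ * (σ * epsLo q r * (epsUp q r)ᵀ).trace) •
          (epsUpD q r * (epsUp q r)ᵀ * (epsLo q r * epsUp q r))) := by
    ext i j
    simp only [Matrix.of_apply, sbar, Rm, if_true, Matrix.smul_apply, Matrix.add_apply,
      Matrix.mul_apply, Matrix.trace, Matrix.diag, Matrix.transpose_apply, Fin.sum_univ_two,
      smul_eq_mul, zero_ne_one, one_ne_zero, if_false]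
    ring
  have hVU : epsUpD q r * (epsUp q r)ᵀ = -1 := by
    rw [epsUpD_eq_neg_transpose, neg_mul, ← Matrix.transpose_mul, epsUp_mul_epsLo hq hr,
      Matrix.transpose_one]
  rw [key, hVU, epsLo_mul_epsUp hq hr]
  simp [smul_add]

theorem Gpair_eq_trace (q r a : ℝ) (s : Bool) (σ τ : Matrix (Fin 2) (Fin 2) ℂ) :
    Gpair q r a s σ τ = 1 / (Qval q r : ℂ) *
      ((epsUp q r)ᵀ * σ * Matrix.of (sbar q r a s τ) * epsLo q r).trace := by
  simp only [Gpair, Matrix.mul_apply, Matrix.trace, Matrix.diag, Matrix.transpose_apply,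
    Fin.sum_univ_two, Matrix.of_apply]
  ring

/-- The metric pairing with the conjugate on the left factor instead of the right one. -/
theorem Gpair_true_eq_trace_dotted {q r : ℝ} (hq : 0 < q) (hr : r ^ 2 < 1) (a : ℝ)
    (σ τ : Matrix (Fin 2) (Fin 2) ℂ) :
    Gpair q r a true σ τ = 1 / (Qval q r : ℂ) *
      (epsLoD q r * Matrix.of (sbar q r a true σ) * τ * (epsUpD q r)ᵀ).trace := by
  have hcycle (X : Matrix (Fin 2) (Fin 2) ℂ) :
      ((epsUp q r)ᵀ * X * epsLo q r).trace = (X * epsLo q r * (epsUp q r)ᵀ).trace := by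
    rw [mul_assoc, Matrix.trace_mul_comm]
  have hD (X : Matrix (Fin 2) (Fin 2) ℂ) : (epsLoD q r * X * (epsUpD q r)ᵀ).trace =
      (X * epsLo q r * (epsUp q r)ᵀ).trace := by
    rw [← hcycle, epsLoD_eq_neg_transpose, epsUpD_eq_neg_transpose]
    simp
  rw [Gpair_eq_trace, mul_assoc (epsUp q r)ᵀ, hcycle, mul_assoc (epsLoD q r), hD,
    sbar_true_eq hq hr, sbar_true_eq hq hr]
  simp only [mul_add, add_mul, Matrix.smul_mul, Matrix.mul_smul, one_mul, mul_one,
    Matrix.trace_smul, Matrix.trace_add, smul_eq_mul]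
  ring

theorem sbarL_eq_sum_smul (q r a : ℝ) (L : Fin 4) :
    Matrix.of (sbarL q r a L) =
      ∑ N, GloM q r a true L N • Matrix.of (sbar q r a true (pauli N)) := by
  ext i j
  simp [sbarL, Matrix.sum_apply]

theorem map_Lor_eq_trace (q r a : ℝ) {A : Type*} [Ring A] [Algebra ℂ A]
    (M Mb : Fin 2 → Fin 2 → A) (e : A →ₐ[ℂ] ℂ)
    (heM : ∀ α β : Fin 2, e (M α β) = if α = β then 1 else 0)
    (heMb : ∀ α β : Fin 2, e (Mb α β) = if α = β then 1 else 0) (L K : Fin 4) :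
    e (Lor q r a M Mb L K) = 1 / (Qval q r : ℂ) *
      (epsLoD q r * Matrix.of (sbarL q r a L) * pauli K * (epsUpD q r)ᵀ).trace := by
  simp only [Lor, map_sum, map_smul, map_mul, smul_eq_mul]
  simp only [heM, heMb, Matrix.mul_apply, Matrix.trace, Matrix.diag, Matrix.transpose_apply,
    Fin.sum_univ_two, Matrix.of_apply, zero_ne_one, one_ne_zero, if_true, if_false]
  ring

end

/-- if `e` is a unital algebra homomorphism with `e(M_α^β) = δ_α^β`
and `e(M̄_α̇^β̇) = δ_α̇^β̇`, then `e(Λ_L^K) = δ_L^K`. -/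
theorem lorentz_counit (q r : ℝ) (hq : 0 < q) (hr : r ^ 2 < 1)
    (a : ℝ) (ha : 0 < a) (haQ : a + a⁻¹ = Qval q r)
    (hG : ∀ s, IsUnit (GupM q r a s).det)
    {A : Type*} [Ring A] [Algebra ℂ A] (M Mb : Fin 2 → Fin 2 → A)
    (hu1 : ∀ γ δ : Fin 2,
      ∑ α, ∑ β, epsLo q r α β • (M γ α * M δ β) = epsLo q r γ δ • (1 : A))
    (hu2 : ∀ α β : Fin 2,
      ∑ γ, ∑ δ, epsUp q r γ δ • (M γ α * M δ β) = epsUp q r α β • (1 : A))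
    (hu3 : ∀ γ δ : Fin 2,
      ∑ α, ∑ β, epsLoD q r α β • (Mb γ α * Mb δ β) = epsLoD q r γ δ • (1 : A))
    (hu4 : ∀ α β : Fin 2,
      ∑ γ, ∑ δ, epsUpD q r γ δ • (Mb γ α * Mb δ β) = epsUpD q r α β • (1 : A))
    (e : A →ₐ[ℂ] ℂ)
    (heM : ∀ α β : Fin 2, e (M α β) = if α = β then 1 else 0)
    (heMb : ∀ α β : Fin 2, e (Mb α β) = if α = β then 1 else 0) :
    ∀ L K : Fin 4, e (Lor q r a M Mb L K) = if L = K then 1 else 0 := by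
  intro L K
  have hGG : GloM q r a true * GupM q r a true = 1 :=
    Matrix.nonsing_inv_mul _ (hG true)
  have hLK : ∑ N, GloM q r a true L N * Gpair q r a true (pauli N) (pauli K) =
      if L = K then 1 else 0 := by
    rw [← Matrix.one_apply, ← hGG, Matrix.mul_apply]
    rfl
  rw [map_Lor_eq_trace q r a M Mb e heM heMb, sbarL_eq_sum_smul, ← hLK]
  simp only [Gpair_true_eq_trace_dotted hq hr, Matrix.sum_mul, Matrix.mul_smul,
    Matrix.smul_mul, Matrix.trace_sum, Matrix.trace_smul, smul_eq_mul, Finset.mul_sum]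
  exact Finset.sum_congr rfl fun N _ => by ring
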